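/- arXiv:1606.01128 — 4 statements merged into one kernel-verified Lean document; each statement's English description precedes it below -/
import Mathlib

section
/- Let E be a real inner product space, let f, g : E → ℝ be convex functions, and let J = f − g. Fix e₀ ∈ E, let δ₀ be a subgradient of g at e₀, and suppose e₁ ∈ E minimizes the function e' ↦ f(e') − g(e₀) − ⟨e' − e₀, δ₀⟩ over E. Then J(e₁) ≤ J(e₀). Consequently, any sequence (e_k) produced by the DC Algorithm (where each e_{k+1} minimizes e' ↦ f(e') − ⟨e', δ_k⟩ for some subgradient δ_k of g at e_k) yields a nonincreasing sequence of values J(e_k). -/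
open Set RealInnerProductSpace

/-- One DCA step decreases the DC criterion J = f − g:
if δ₀ is a subgradient of g at e₀ and e₁ minimizes
e' ↦ f(e') − g(e₀) − ⟪e' − e₀, δ₀⟫, then J(e₁) ≤ J(e₀).
Consequently, any DCA sequence (e_k) (where e_{k+1} minimizes
e' ↦ f(e') − ⟪e', δ_k⟫ for some subgradient δ_k of g at e_k) yields a
nonincreasing sequence of values J(e_k). -/
theorem dca_decreasing {E : Type*} [NormedAddCommGroup E] [InnerProductSpace ℝ E]
    (f g : E → ℝ) (hf : ConvexOn ℝ univ f) (hg : ConvexOn ℝ univ g)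
    (J : E → ℝ) (hJ : ∀ x, J x = f x - g x)
    (e₀ δ₀ : E) (hδ₀ : ∀ e' : E, g e' ≥ g e₀ + ⟪e' - e₀, δ₀⟫)
    (e₁ : E)
    (he₁ : ∀ e' : E, f e₁ - g e₀ - ⟪e₁ - e₀, δ₀⟫ ≤ f e' - g e₀ - ⟪e' - e₀, δ₀⟫) :
    J e₁ ≤ J e₀ ∧
    ∀ (e : ℕ → E) (δ : ℕ → E),
      (∀ k, ∀ e' : E, g e' ≥ g (e k) + ⟪e' - e k, δ k⟫) →
      (∀ k, ∀ e' : E, f (e (k + 1)) - ⟪e (k + 1), δ k⟫ ≤ f e' - ⟪e', δ k⟫) →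
      Antitone fun k => J (e k) := by
  constructor
  · have h1 := hδ₀ e₁
    have h2 := he₁ e₀
    simp only [sub_self, inner_zero_left] at h2
    rw [hJ, hJ]
    linarith
  · intro e δ hδ he
    refine antitone_nat_of_succ_le fun k => ?_
    have h1 := hδ k (e (k + 1))
    have h2 := he k (e k)
    rw [inner_sub_left] at h1
    simp only [hJ]
    linarith
end

section
/- Fix a discount factor γ ∈ (0,1), nonempty finite sets S, A, a feature map φ : S × A → ℝ^d, samples (s_j, a_j) ∈ S × A with rewards r_j ∈ ℝ for j = 1,…,N, and transition probabilities P with P(s'|s_j,a_j) ≥ 0 and Σ_{s'} P(s'|s_j,a_j) = 1. Define J_RL(θ) = (1/N) Σ_{j=1}^N | r_j + γ Σ_{s'∈S} P(s'|s_j,a_j) max_{a∈A} ⟨φ(s',a), θ⟩ − ⟨φ(s_j,a_j), θ⟩ |. Then J_RL = f_RL − g_RL where f_RL(θ) = (1/N) Σ_j 2·max( r_j + γ Σ_{s'} P(s'|s_j,a_j) max_a ⟨φ(s',a), θ⟩, ⟨φ(s_j,a_j), θ⟩ ) and g_RL(θ) = (1/N) Σ_j ( r_j + γ Σ_{s'}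 P(s'|s_j,a_j) max_a ⟨φ(s',a), θ⟩ + ⟨φ(s_j,a_j), θ⟩ ), and both f_RL and g_RL are convex functions on ℝ^d. In particular the empirical optimal Bellman residual criterion J_RL is a DC function of θ. -/
open Set RealInnerProductSpace

theorem convexOn_finsum_aux {E ι : Type*} [AddCommGroup E] [Module ℝ E]
    (t : Finset ι) (F : ι → E → ℝ) (h : ∀ i, ConvexOn ℝ univ (F i)) :
    ConvexOn ℝ univ (fun x => ∑ i ∈ t, F i x) := by
  classical
  induction t using Finset.induction_on with
  | empty => simpa using convexOn_const (0 : ℝ) (convex_univ (𝕜 := ℝ) (E := E))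
  | insert i t hi ih =>
    simp only [Finset.sum_insert hi]
    exact (h i).add ih

theorem convexOn_mul_aux {E : Type*} [AddCommGroup E] [Module ℝ E]
    (c : ℝ) (hc : 0 ≤ c) (F : E → ℝ) (h : ConvexOn ℝ univ F) :
    ConvexOn ℝ univ (fun x => c * F x) := by
  simpa using h.smul hc

theorem convexOn_inner_aux {d : ℕ} (v : EuclideanSpace ℝ (Fin d)) :
    ConvexOn ℝ univ (fun θ : EuclideanSpace ℝ (Fin d) => ⟪v, θ⟫) := by
  refine ⟨convex_univ, fun x _ y _ p q _ _ _ => ?_⟩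
  simp [inner_add_right, inner_smul_right]

theorem convexOn_sup_aux {d : ℕ} {A : Type*} [Fintype A] [Nonempty A]
    (v : A → EuclideanSpace ℝ (Fin d)) :
    ConvexOn ℝ univ (fun θ : EuclideanSpace ℝ (Fin d) =>
      Finset.univ.sup' Finset.univ_nonempty (fun b : A => ⟪v b, θ⟫)) := by
  refine ⟨convex_univ, fun x _ y _ p q hp hq _ => ?_⟩
  refine Finset.sup'_le _ _ fun b hb => ?_
  have hx := Finset.le_sup' (fun b : A => ⟪v b, x⟫) hb
  have hy := Finset.le_sup' (fun b : A => ⟪v b, y⟫) hb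
  simp only [inner_add_right, inner_smul_right, smul_eq_mul]
  exact add_le_add (mul_le_mul_of_nonneg_left hx hp) (mul_le_mul_of_nonneg_left hy hq)

/-- The empirical optimal Bellman residual criterion
J_RL(θ) = (1/N) Σ_j |r_j + γ Σ_{s'} P(s'|s_j,a_j) max_a ⟨φ(s',a), θ⟩ − ⟨φ(s_j,a_j), θ⟩|
is DC, with explicit decomposition J_RL = f_RL − g_RL where both f_RL and g_RL
are convex on ℝ^d. -/
theorem JRL_is_dc {d : ℕ} {S A : Type*}
    [Fintype S] [Nonempty S] [Fintype A] [Nonempty A]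
    (γ : ℝ) (hγ : γ ∈ Set.Ioo (0 : ℝ) 1)
    (φ : S × A → EuclideanSpace ℝ (Fin d))
    (N : ℕ) (hN : 0 < N)
    (s : Fin N → S) (a : Fin N → A) (r : Fin N → ℝ)
    (P : Fin N → S → ℝ)
    (hP0 : ∀ (j : Fin N) (s' : S), 0 ≤ P j s')
    (hP1 : ∀ j : Fin N, ∑ s' : S, P j s' = 1)
    (JRL fRL gRL : EuclideanSpace ℝ (Fin d) → ℝ)
    (hJ : ∀ θ, JRL θ = (1 / (N : ℝ)) * ∑ j : Fin N,
      |r j + γ * ∑ s' : S, P j s' *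
          Finset.univ.sup' Finset.univ_nonempty (fun b : A => ⟪φ (s', b), θ⟫)
        - ⟪φ (s j, a j), θ⟫|)
    (hf : ∀ θ, fRL θ = (1 / (N : ℝ)) * ∑ j : Fin N,
      2 * max
        (r j + γ * ∑ s' : S, P j s' *
          Finset.univ.sup' Finset.univ_nonempty (fun b : A => ⟪φ (s', b), θ⟫))
        (⟪φ (s j, a j), θ⟫))
    (hg : ∀ θ, gRL θ = (1 / (N : ℝ)) * ∑ j : Fin N,
      (r j + γ * ∑ s' : S, P j s' *
          Finset.univ.sup' Finset.univ_nonempty (fun b : A => ⟪φ (s', b), θ⟫)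
        + ⟪φ (s j, a j), θ⟫)) :
    ConvexOn ℝ univ fRL ∧ ConvexOn ℝ univ gRL ∧ ∀ θ, JRL θ = fRL θ - gRL θ := by
  have hT : ∀ j : Fin N, ConvexOn ℝ univ (fun θ : EuclideanSpace ℝ (Fin d) =>
      r j + γ * ∑ s' : S, P j s' *
          Finset.univ.sup' Finset.univ_nonempty (fun b : A => ⟪φ (s', b), θ⟫)) := fun j =>
    (convexOn_const (r j) convex_univ).add
      (convexOn_mul_aux γ hγ.1.le _ (convexOn_finsum_aux _ _ fun s' =>
        convexOn_mul_aux _ (hP0 j s') _ (convexOn_sup_aux fun b => φ (s', b))))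
  have hN' : 0 ≤ 1 / (N : ℝ) := by positivity
  refine ⟨?_, ?_, fun θ => ?_⟩
  · rw [funext hf]
    exact convexOn_mul_aux _ hN' _ (convexOn_finsum_aux _ _ fun j =>
      convexOn_mul_aux 2 zero_le_two _ ((hT j).sup (convexOn_inner_aux _)))
  · rw [funext hg]
    exact convexOn_mul_aux _ hN' _ (convexOn_finsum_aux _ _ fun j =>
      (hT j).add (convexOn_inner_aux _))
  · rw [hJ, hf, hg, ← mul_sub, ← Finset.sum_sub_distrib]
    congr 1
    refine Finset.sum_congr rfl fun j _ => ?_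
    generalize r j + γ * ∑ s' : S, P j s' *
          Finset.univ.sup' Finset.univ_nonempty (fun b : A => ⟪φ (s', b), θ⟫) = u
    generalize ⟪φ (s j, a j), θ⟫ = w
    rcases le_total u w with h | h
    · rw [max_eq_right h, abs_of_nonpos (by linarith)]; ring
    · rw [max_eq_left h, abs_of_nonneg (by linarith)]; ring
end

section
/- Fix γ ∈ (0,1), nonempty finite sets S, A, a feature map φ : S × A → ℝ^d, expert samples (s_i, a_i), i = 1,…,N_E, a margin function l : S × A × A → ℝ, RL samples (s_j, a_j) with rewards r_j, j = 1,…,N_RL, transition probabilities P(·|s_j,a_j) (nonnegative, summing to 1 over S), and λ ≥ 0. Let J_E(θ) = (1/N_E) Σ_i ( max_{a} [⟨φ(s_i,a),θ⟩ + l(s_i,a_i,a)] − ⟨φ(s_i,a_i),θ⟩ ) and J_RL(θ) = (1/N_RL) Σ_j | r_j + γ Σ_{s'} P(s'|s_j,a_j) max_a ⟨φ(s',a),θ⟩ − ⟨φ(s_j,a_j),θ⟩ |. Then J_RLED = J_E + λ·J_RL is a DC function on ℝ^d, with explicit decomposition J_RLED = f_RLED − g_RLED where f_RLED(θ) = J_E(θ)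 + λ·(1/N_RL) Σ_j 2·max( r_j + γ Σ_{s'} P(s'|s_j,a_j) max_a ⟨φ(s',a),θ⟩, ⟨φ(s_j,a_j),θ⟩ ) and g_RLED(θ) = λ·(1/N_RL) Σ_j ( r_j + γ Σ_{s'} P(s'|s_j,a_j) max_a ⟨φ(s',a),θ⟩ + ⟨φ(s_j,a_j),θ⟩ ), and both f_RLED and g_RLED are convex. -/
open Set RealInnerProductSpace

theorem cvx_inner {d : ℕ} (v : EuclideanSpace ℝ (Fin d)) (c : ℝ) (k : ℝ) :
    ConvexOn ℝ univ (fun θ : EuclideanSpace ℝ (Fin d) => c * ⟪v, θ⟫ + k) := by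
  refine ⟨convex_univ, ?_⟩
  intro x _ y _ p q _ _ hpq
  simp only [inner_add_right, inner_smul_right, smul_eq_mul]
  have : k = (p + q) * k := by rw [hpq, one_mul]
  nlinarith

theorem cvx_sum {d : ℕ} {ι : Type*} (t : Finset ι) (f : ι → EuclideanSpace ℝ (Fin d) → ℝ)
    (h : ∀ i, ConvexOn ℝ univ (f i)) : ConvexOn ℝ univ (fun θ => ∑ i ∈ t, f i θ) := by
  refine ⟨convex_univ, ?_⟩
  intro x hx y hy p q hp hq hpq
  simp only [smul_eq_mul, Finset.mul_sum, ← Finset.sum_add_distrib]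
  exact Finset.sum_le_sum fun i _ => (h i).2 hx hy hp hq hpq

theorem cvx_mul {d : ℕ} {c : ℝ} (hc : 0 ≤ c) {f : EuclideanSpace ℝ (Fin d) → ℝ}
    (h : ConvexOn ℝ univ f) : ConvexOn ℝ univ (fun θ => c * f θ) := h.smul hc

theorem cvx_sup {d : ℕ} {A : Type*} [Fintype A] [Nonempty A]
    (f : A → EuclideanSpace ℝ (Fin d) → ℝ)
    (h : ∀ i, ConvexOn ℝ univ (f i)) :
    ConvexOn ℝ univ (fun θ => Finset.univ.sup' Finset.univ_nonempty (fun b : A => f b θ)) := by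
  refine ⟨convex_univ, ?_⟩
  intro x hx y hy p q hp hq hpq
  refine Finset.sup'_le _ _ fun b _ => ((h b).2 hx hy hp hq hpq).trans ?_
  simp only [smul_eq_mul]
  exact add_le_add
    (mul_le_mul_of_nonneg_left (Finset.le_sup' (fun b => f b x) (Finset.mem_univ b)) hp)
    (mul_le_mul_of_nonneg_left (Finset.le_sup' (fun b => f b y) (Finset.mem_univ b)) hq)

/-- J_RLED = J_E + λ·J_RL is a DC function on ℝ^d, with explicit
decomposition J_RLED = f_RLED − g_RLED where
f_RLED(θ) = J_E(θ) + λ·(1/N_RL) Σ_j 2·max(r_j + γ Σ_{s'} P(s'|s_j,a_j) max_a ⟨φ(s',a),θ⟩, ⟨φ(s_j,a_j),θ⟩)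
and
g_RLED(θ) = λ·(1/N_RL) Σ_j (r_j + γ Σ_{s'} P(s'|s_j,a_j) max_a ⟨φ(s',a),θ⟩ + ⟨φ(s_j,a_j),θ⟩),
and both f_RLED and g_RLED are convex. -/
theorem JRLED_is_dc {d : ℕ} {S A : Type*}
    [Fintype S] [Nonempty S] [Fintype A] [Nonempty A]
    (γ : ℝ) (hγ : γ ∈ Set.Ioo (0 : ℝ) 1)
    (φ : S × A → EuclideanSpace ℝ (Fin d))
    (NE : ℕ) (sE : Fin NE → S) (aE : Fin NE → A)
    (l : S × A × A → ℝ)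
    (NRL : ℕ) (s : Fin NRL → S) (a : Fin NRL → A) (r : Fin NRL → ℝ)
    (P : Fin NRL → S → ℝ)
    (hP0 : ∀ (j : Fin NRL) (s' : S), 0 ≤ P j s')
    (hP1 : ∀ j : Fin NRL, ∑ s' : S, P j s' = 1)
    (lam : ℝ) (hlam : 0 ≤ lam)
    (JE JRL JRLED fRLED gRLED : EuclideanSpace ℝ (Fin d) → ℝ)
    (hJE : ∀ θ, JE θ = (1 / (NE : ℝ)) * ∑ i : Fin NE,
      (Finset.univ.sup' Finset.univ_nonempty
          (fun b : A => ⟪φ (sE i, b), θ⟫ + l (sE i, aE i, b))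
        - ⟪φ (sE i, aE i), θ⟫))
    (hJRL : ∀ θ, JRL θ = (1 / (NRL : ℝ)) * ∑ j : Fin NRL,
      |r j + γ * ∑ s' : S, P j s' *
          Finset.univ.sup' Finset.univ_nonempty (fun b : A => ⟪φ (s', b), θ⟫)
        - ⟪φ (s j, a j), θ⟫|)
    (hJRLED : ∀ θ, JRLED θ = JE θ + lam * JRL θ)
    (hf : ∀ θ, fRLED θ = JE θ + lam * ((1 / (NRL : ℝ)) * ∑ j : Fin NRL,
      2 * max
        (r j + γ * ∑ s' : S, P j s' *
          Finset.univ.sup' Finset.univ_nonempty (fun b : A => ⟪φ (s', b), θ⟫))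
        (⟪φ (s j, a j), θ⟫)))
    (hg : ∀ θ, gRLED θ = lam * ((1 / (NRL : ℝ)) * ∑ j : Fin NRL,
      (r j + γ * ∑ s' : S, P j s' *
          Finset.univ.sup' Finset.univ_nonempty (fun b : A => ⟪φ (s', b), θ⟫)
        + ⟪φ (s j, a j), θ⟫))) :
    ConvexOn ℝ univ fRLED ∧ ConvexOn ℝ univ gRLED ∧
    ∀ θ, JRLED θ = fRLED θ - gRLED θ := by
  have hin : ∀ v : EuclideanSpace ℝ (Fin d),
      ConvexOn ℝ univ (fun θ : EuclideanSpace ℝ (Fin d) => ⟪v, θ⟫) := fun v => by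
    simpa using cvx_inner v 1 0
  have hJEc : ConvexOn ℝ univ JE := by
    rw [funext hJE]
    refine cvx_mul (by positivity) (cvx_sum _ _ fun i => ?_)
    have h1 := cvx_sup (fun (b : A) θ => ⟪φ (sE i, b), θ⟫ + l (sE i, aE i, b))
      (fun b => by simpa using cvx_inner (φ (sE i, b)) 1 (l (sE i, aE i, b)))
    have h2 := h1.add (cvx_inner (φ (sE i, aE i)) (-1) 0)
    refine h2.congr fun θ _ => ?_
    simp only [Pi.add_apply]
    ring
  have hV : ∀ j, ConvexOn ℝ univ (fun θ : EuclideanSpace ℝ (Fin d) =>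
      r j + γ * ∑ s' : S, P j s' *
        Finset.univ.sup' Finset.univ_nonempty (fun b : A => ⟪φ (s', b), θ⟫)) := fun j =>
    (convexOn_const (r j) convex_univ).add (cvx_mul hγ.1.le (cvx_sum _ _ fun s' =>
      cvx_mul (hP0 j s') (cvx_sup _ fun b => hin _)))
  refine ⟨?_, ?_, ?_⟩
  · rw [funext hf]
    exact hJEc.add (cvx_mul hlam (cvx_mul (by positivity) (cvx_sum _ _ fun j =>
      cvx_mul zero_le_two ((hV j).sup (hin _)))))
  · rw [funext hg]
    exact cvx_mul hlam (cvx_mul (by positivity) (cvx_sum _ _ fun j => (hV j).add (hin _)))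
  · intro θ
    rw [hJRLED, hf, hg, hJRL, add_sub_assoc, ← mul_sub, ← mul_sub, ← Finset.sum_sub_distrib]
    congr 3
    refine Finset.sum_congr rfl fun j _ => ?_
    rw [← max_sub_min_eq_abs', ← max_add_min (r j + _) (⟪φ (s j, a j), θ⟫)]
    ring
end

section
/- Let S and A be nonempty finite sets, R : S × A → ℝ, γ ∈ (0,1), P transition probabilities (P(s'|s,a) ≥ 0, Σ_{s'} P(s'|s,a) = 1). Let Q* be the unique fixed point of the optimal Bellman operator T*, let Q : S × A → ℝ be arbitrary, let π : S → A be greedy with respect to Q (π(s) ∈ argmax_{a∈A} Q(s,a) for all s), and let Q^π be the unique fixed point of T^π. Then ‖Q* − Q^π‖_∞ ≤ (2/(1−γ)) ‖T*Q − Q‖_∞, where ‖·‖_∞ is the supremum norm over S × A. (This is the supremum-norm instance of the bound ‖Q* − Q^π‖_{p,ν} ≤ C/(1−γ) · J_RL(Q) stated in the paper, showing that minimizing the optimal Bellman residual yields a function whose greedy policy is near-optimal.) -/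
theorem obr_aux {S A : Type*} [Fintype S] [Nonempty S] [Fintype A] [Nonempty A]
    (R : S × A → ℝ) (γ : ℝ) (hγ : γ ∈ Set.Ioo (0 : ℝ) 1)
    (P : S × A → S → ℝ)
    (hP0 : ∀ (sa : S × A) (s' : S), 0 ≤ P sa s')
    (hP1 : ∀ sa : S × A, ∑ s' : S, P sa s' = 1)
    (G Q V : S × A → ℝ) (g q : S → ℝ) (ε : ℝ)
    (hG : ∀ sa, G sa = R sa + γ * ∑ s', P sa s' * g s')
    (hV : ∀ sa, V sa = R sa + γ * ∑ s', P sa s' * q s')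
    (hgq : ∀ M : ℝ, (∀ sa, |G sa - Q sa| ≤ M) → ∀ s, |g s - q s| ≤ M)
    (hε : ∀ sa, |V sa - Q sa| ≤ ε) (sa : S × A) : |G sa - Q sa| ≤ ε / (1 - γ) := by
  obtain ⟨h0, h1⟩ := hγ
  obtain ⟨m, hm⟩ := Finite.exists_max (fun sa => |G sa - Q sa|)
  have hb := hgq _ hm
  have h2 : |G m - V m| ≤ γ * |G m - Q m| := by
    have e : G m - V m = γ * ∑ s', P m s' * (g s' - q s') := by
      rw [hG, hV]
      simp only [mul_sub, Finset.sum_sub_distrib]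
      ring
    rw [e, abs_mul, abs_of_pos h0]
    apply mul_le_mul_of_nonneg_left _ h0.le
    calc |∑ s', P m s' * (g s' - q s')| ≤ ∑ s', |P m s' * (g s' - q s')| :=
          Finset.abs_sum_le_sum_abs _ _
      _ ≤ ∑ s', P m s' * |G m - Q m| := by
          apply Finset.sum_le_sum
          intro s _
          rw [abs_mul, abs_of_nonneg (hP0 m s)]
          exact mul_le_mul_of_nonneg_left (hb s) (hP0 m s)
      _ = |G m - Q m| := by rw [← Finset.sum_mul, hP1, one_mul]
  have h3 := abs_sub_le (G m) (V m) (Q m)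
  refine (hm sa).trans ?_
  rw [le_div_iff₀ (by linarith)]
  have := hε m
  linarith


/-- If Q* is the unique fixed point of T*, π is greedy with
respect to an arbitrary Q, and Q^π is the unique fixed point of T^π, then
‖Q* − Q^π‖_∞ ≤ (2/(1−γ)) ‖T*Q − Q‖_∞ (supremum-norm optimal Bellman residual
bound). -/
theorem obr_minimization_bound {S A : Type*}
    [Fintype S] [Nonempty S] [Fintype A] [Nonempty A]
    (R : S × A → ℝ) (γ : ℝ) (hγ : γ ∈ Set.Ioo (0 : ℝ) 1)
    (P : S × A → S → ℝ)
    (hP0 : ∀ (sa : S × A) (s' : S), 0 ≤ P sa s')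
    (hP1 : ∀ sa : S × A, ∑ s' : S, P sa s' = 1)
    (Tstar : (S × A → ℝ) → S × A → ℝ)
    (hTstar : ∀ (Q : S × A → ℝ) (sa : S × A), Tstar Q sa = R sa + γ * ∑ s' : S,
      P sa s' * Finset.univ.sup' Finset.univ_nonempty (fun b : A => Q (s', b)))
    (Qstar : S × A → ℝ) (hQstar : Tstar Qstar = Qstar)
    (Q : S × A → ℝ)
    (π : S → A)
    (hgreedy : ∀ s : S, Q (s, π s) =
      Finset.univ.sup' Finset.univ_nonempty (fun a : A => Q (s, a)))
    (Tpi : (S × A → ℝ) → S × A → ℝ)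
    (hTpi : ∀ (Q' : S × A → ℝ) (sa : S × A),
      Tpi Q' sa = R sa + γ * ∑ s' : S, P sa s' * Q' (s', π s'))
    (Qpi : S × A → ℝ) (hQpi : Tpi Qpi = Qpi) :
    Finset.univ.sup' Finset.univ_nonempty (fun sa : S × A => |Qstar sa - Qpi sa|)
      ≤ (2 / (1 - γ)) *
        Finset.univ.sup' Finset.univ_nonempty
          (fun sa : S × A => |Tstar Q sa - Q sa|) := by
  have hε : ∀ sa, |Tstar Q sa - Q sa| ≤ Finset.univ.sup' Finset.univ_nonempty
      (fun sa : S × A => |Tstar Q sa - Q sa|) := fun sa =>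
    Finset.le_sup' (fun sa : S × A => |Tstar Q sa - Q sa|) (Finset.mem_univ sa)
  generalize Finset.univ.sup' Finset.univ_nonempty
      (fun sa : S × A => |Tstar Q sa - Q sa|) = ε at hε ⊢
  have a1 := obr_aux R γ hγ P hP0 hP1 Qstar Q (Tstar Q)
    (fun s => Finset.univ.sup' Finset.univ_nonempty (fun b : A => Qstar (s, b)))
    (fun s => Finset.univ.sup' Finset.univ_nonempty (fun b : A => Q (s, b))) ε
    (fun sa => by rw [← hTstar, hQstar]) (hTstar Q)
    (by
      intro M hM s
      rw [abs_sub_le_iff]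
      constructor
      · rw [sub_le_iff_le_add]
        apply Finset.sup'_le
        intro b _
        have h1 := (abs_sub_le_iff.1 (hM (s, b))).1
        have h2 := Finset.le_sup' (fun b : A => Q (s, b)) (Finset.mem_univ b)
        linarith
      · rw [sub_le_iff_le_add]
        apply Finset.sup'_le
        intro b _
        have h1 := (abs_sub_le_iff.1 (hM (s, b))).2
        have h2 := Finset.le_sup' (fun b : A => Qstar (s, b)) (Finset.mem_univ b)
        linarith) hε
  have a2 := obr_aux R γ hγ P hP0 hP1 Qpi Q (Tstar Q)
    (fun s => Qpi (s, π s)) (fun s => Q (s, π s)) ε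
    (fun sa => by rw [← hTpi, hQpi]) (fun sa => by simp only [hTstar, hgreedy])
    (fun M hM s => hM (s, π s)) hε
  apply Finset.sup'_le
  intro sa _
  have h1 := a1 sa
  have h2 := a2 sa
  have h3 := abs_sub_le (Qstar sa) (Q sa) (Qpi sa)
  rw [abs_sub_comm (Q sa)] at h3
  have e : 2 / (1 - γ) * ε = ε / (1 - γ) + ε / (1 - γ) := by ring
  rw [e]
  linarith
end
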